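/- arXiv:2101.09013 — 5 statements merged into one kernel-verified Lean document; each statement's English description precedes it below -/
import Mathlib

section
/- Let A, B ∈ ℝ² with L := ‖A − B‖ > 0, let 0 ≤ ε ≤ 1 and 0 ≤ δ ≤ 1, and let C, D ∈ ℝ² with ‖C − A‖ ≤ δL and ‖D − B‖ ≤ δL. Let η : [0,1] → ℝ² be a curve parametrized with constant speed, with η(0) = C, η(1) = D and length ℓ(η) ≤ (1+ε)L, and let γ : [0,1] → ℝ² be the constant speed parametrization of the segment from A to B, i.e. γ(t) = (1−t)·A + t·B. Then for every t ∈ [0,1] one has ‖η(t) − γ(t)‖ ≤ 3·√(2ε+δ)·L. -/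
open Set Filter MeasureTheory

/-- If `η` is a constant-speed curve of length at most `(1+ε)L` joining
points `C ∈ B(A, δL)` and `D ∈ B(B, δL)`, and `γ` is the constant-speed parametrization of
the segment from `A` to `B`, then `‖η t - γ t‖ ≤ 3√(2ε+δ) L` for every `t ∈ [0,1]`. -/
theorem stmt_0
    (A B C D : EuclideanSpace ℝ (Fin 2)) (L ε δ : ℝ)
    (hL : L = ‖A - B‖) (hLpos : 0 < L)
    (hε0 : 0 ≤ ε) (hε1 : ε ≤ 1) (hδ0 : 0 ≤ δ) (hδ1 : δ ≤ 1)
    (hC : ‖C - A‖ ≤ δ * L) (hD : ‖D - B‖ ≤ δ * L)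
    (η : ℝ → EuclideanSpace ℝ (Fin 2)) (ℓ : ℝ) (hℓ : 0 ≤ ℓ)
    (hspeed : ∀ s t : ℝ, 0 ≤ s → s ≤ t → t ≤ 1 →
      eVariationOn η (Set.Icc s t) = ENNReal.ofReal (ℓ * (t - s)))
    (hη0 : η 0 = C) (hη1 : η 1 = D)
    (hlen : ℓ ≤ (1 + ε) * L) :
    ∀ t ∈ Set.Icc (0 : ℝ) 1,
      ‖η t - ((1 - t) • A + t • B)‖ ≤ 3 * Real.sqrt (2 * ε + δ) * L := by
  intro t ht
  obtain ⟨h0, h1⟩ := ht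
  have key : ∀ s u : ℝ, 0 ≤ s → s ≤ u → u ≤ 1 → dist (η s) (η u) ≤ ℓ * (u - s) := by
    intro s u hs hsu hu
    have h := eVariationOn.edist_le η (s := Set.Icc s u) (x := s) (y := u)
      ⟨le_refl _, hsu⟩ ⟨hsu, le_refl _⟩
    rw [hspeed s u hs hsu hu, edist_dist] at h
    exact (ENNReal.ofReal_le_ofReal_iff (mul_nonneg hℓ (by linarith))).1 h
  have hPC : ‖η t - C‖ ≤ ℓ * t := by
    have h := key 0 t le_rfl h0 h1
    rw [hη0, dist_comm, dist_eq_norm] at h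
    simpa using h
  have hPD : ‖η t - D‖ ≤ ℓ * (1 - t) := by
    have h := key t 1 h0 h1 le_rfl
    rwa [hη1, dist_eq_norm] at h
  have hCD : (1 - 2 * δ) * L ≤ ‖C - D‖ := by
    have h : ‖A - B‖ ≤ ‖C - A‖ + ‖C - D‖ + ‖D - B‖ := by
      have e : A - B = -(C - A) + (C - D) + (D - B) := by abel
      rw [e]
      refine (norm_add₃_le).trans ?_
      rw [norm_neg]
    linarith
  have hCD2 : (1 - 4 * δ) * L ^ 2 ≤ ‖C - D‖ ^ 2 := by
    nlinarith [sq_nonneg (‖C - D‖ - L), mul_le_mul_of_nonneg_right hCD hLpos.le]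
  have hl2 : ℓ ^ 2 ≤ (1 + 3 * ε) * L ^ 2 := by
    have a : ℓ ^ 2 ≤ ((1 + ε) * L) ^ 2 := pow_le_pow_left₀ hℓ hlen 2
    have b : (1 + ε) ^ 2 ≤ 1 + 3 * ε := by nlinarith
    have c := mul_le_mul_of_nonneg_right b (sq_nonneg L)
    nlinarith
  have hid : ‖η t - ((1 - t) • C + t • D)‖ ^ 2
      = (1 - t) * ‖η t - C‖ ^ 2 + t * ‖η t - D‖ ^ 2 - t * (1 - t) * ‖C - D‖ ^ 2 := by
    simp only [EuclideanSpace.norm_sq_eq, Fin.sum_univ_two, Real.norm_eq_abs, sq_abs,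
      PiLp.sub_apply, PiLp.add_apply, PiLp.smul_apply, smul_eq_mul]
    ring
  have hPC2 := pow_le_pow_left₀ (norm_nonneg _) hPC 2
  have hPD2 := pow_le_pow_left₀ (norm_nonneg _) hPD 2
  have hq : ‖η t - ((1 - t) • C + t • D)‖ ^ 2 ≤ (2 * ε + δ) * L ^ 2 := by
    have a := mul_le_mul_of_nonneg_left hPC2 (sub_nonneg.2 h1)
    have b := mul_le_mul_of_nonneg_left hPD2 h0
    have tt : 0 ≤ t * (1 - t) := mul_nonneg h0 (sub_nonneg.2 h1)
    have tt2 : t * (1 - t) ≤ 1 / 4 := by nlinarith [sq_nonneg (2 * t - 1)]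
    have c : ℓ ^ 2 - ‖C - D‖ ^ 2 ≤ (3 * ε + 4 * δ) * L ^ 2 := by linarith
    have d := mul_le_mul_of_nonneg_left c tt
    have hp : 0 ≤ (3 * ε + 4 * δ) * L ^ 2 := by positivity
    have e := mul_le_mul_of_nonneg_right tt2 hp
    have f : 0 ≤ ε * L ^ 2 := by positivity
    rw [hid]
    linarith
  have hs0 : 0 ≤ 2 * ε + δ := by positivity
  have hq1 : ‖η t - ((1 - t) • C + t • D)‖ ≤ Real.sqrt (2 * ε + δ) * L := by
    refine (pow_le_pow_iff_left₀ (norm_nonneg _) (by positivity) two_ne_zero).1 ?_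
    rw [mul_pow, Real.sq_sqrt hs0]
    exact hq
  have hδs : δ ≤ Real.sqrt (2 * ε + δ) := by
    apply Real.le_sqrt_of_sq_le
    nlinarith
  have hr : ‖((1 - t) • C + t • D) - ((1 - t) • A + t • B)‖ ≤ δ * L := by
    have e : ((1 - t) • C + t • D) - ((1 - t) • A + t • B)
        = (1 - t) • (C - A) + t • (D - B) := by
      rw [smul_sub, smul_sub]; abel
    rw [e]
    refine (norm_add_le _ _).trans ?_
    rw [norm_smul, norm_smul, Real.norm_of_nonneg h0, Real.norm_of_nonneg (sub_nonneg.2 h1)]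
    have a := mul_le_mul_of_nonneg_left hC (sub_nonneg.2 h1)
    have b := mul_le_mul_of_nonneg_left hD h0
    linarith
  have htri := norm_sub_le_norm_sub_add_norm_sub (η t) ((1 - t) • C + t • D)
    ((1 - t) • A + t • B)
  have g := mul_le_mul_of_nonneg_right hδs hLpos.le
  have g2 : 0 ≤ Real.sqrt (2 * ε + δ) * L := by positivity
  linarith
end

section
/- Let A, B ∈ ℝ² with L := ‖A − B‖ > 0 and let 0 ≤ ε ≤ 1, 0 ≤ δ ≤ 1. Let η₁, η₂ : [0,1] → ℝ² be two curves parametrized with constant speed, each of length at most (1+ε)L, such that for i = 1, 2 one has ‖ηᵢ(0) − A‖ ≤ δL and ‖ηᵢ(1) − B‖ ≤ δL. Then for every t ∈ [0,1] one has ‖η₁(t) − η₂(t)‖ ≤ 6·√(2ε+δ)·L. -/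
open Set Filter MeasureTheory

lemma aux_dist (η : ℝ → EuclideanSpace ℝ (Fin 2)) (ℓ : ℝ) (hℓ : 0 ≤ ℓ)
    (hspeed : ∀ s t : ℝ, 0 ≤ s → s ≤ t → t ≤ 1 →
      eVariationOn η (Set.Icc s t) = ENNReal.ofReal (ℓ * (t - s)))
    (s t : ℝ) (hs : 0 ≤ s) (hst : s ≤ t) (ht : t ≤ 1) : ‖η s - η t‖ ≤ ℓ * (t - s) := by
  have h := eVariationOn.edist_le η (left_mem_Icc.2 hst) (right_mem_Icc.2 hst)
  rw [hspeed s t hs hst ht, edist_dist,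
    ENNReal.ofReal_le_ofReal_iff (mul_nonneg hℓ (by linarith)), dist_eq_norm] at h
  exact h

lemma aux_stewart (u v : EuclideanSpace ℝ (Fin 2)) (t : ℝ) :
    ‖(1 - t) • u + t • v‖ ^ 2 = (1 - t) * ‖u‖ ^ 2 + t * ‖v‖ ^ 2 - t * (1 - t) * ‖u - v‖ ^ 2 := by
  rw [@norm_add_sq_real, @norm_sub_sq_real, norm_smul, norm_smul, mul_pow, mul_pow,
    real_inner_smul_left, real_inner_smul_right, Real.norm_eq_abs, Real.norm_eq_abs,
    sq_abs, sq_abs]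
  ring

lemma aux_curve (A B : EuclideanSpace ℝ (Fin 2)) (L ε δ : ℝ)
    (hL : L = ‖A - B‖) (hLpos : 0 < L)
    (hε0 : 0 ≤ ε) (hε1 : ε ≤ 1) (hδ0 : 0 ≤ δ) (hδ1 : δ ≤ 1)
    (η : ℝ → EuclideanSpace ℝ (Fin 2)) (ℓ : ℝ) (hℓ : 0 ≤ ℓ)
    (hspeed : ∀ s t : ℝ, 0 ≤ s → s ≤ t → t ≤ 1 →
      eVariationOn η (Set.Icc s t) = ENNReal.ofReal (ℓ * (t - s)))
    (hlen : ℓ ≤ (1 + ε) * L)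
    (hA : ‖η 0 - A‖ ≤ δ * L) (hB : ‖η 1 - B‖ ≤ δ * L) (t : ℝ) (h0 : 0 ≤ t) (h1 : t ≤ 1) :
    ‖η t - ((1 - t) • A + t • B)‖ ≤ 3 * Real.sqrt (2 * ε + δ) * L := by
  have ha : ‖η t - A‖ ≤ (t * (1 + ε) + δ) * L := by
    have e1 := aux_dist η ℓ hℓ hspeed 0 t le_rfl h0 h1
    rw [norm_sub_rev] at e1
    have e2 := norm_sub_le_norm_sub_add_norm_sub (η t) (η 0) A
    have e3 := mul_le_mul_of_nonneg_right hlen h0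
    linarith
  have hb : ‖η t - B‖ ≤ ((1 - t) * (1 + ε) + δ) * L := by
    have e1 := aux_dist η ℓ hℓ hspeed t 1 h0 h1 le_rfl
    have e2 := norm_sub_le_norm_sub_add_norm_sub (η t) (η 1) B
    have e3 := mul_le_mul_of_nonneg_right hlen (sub_nonneg.2 h1)
    linarith
  have key := aux_stewart (η t - A) (η t - B) t
  have e : (1 - t) • (η t - A) + t • (η t - B) = η t - ((1 - t) • A + t • B) := by module
  have e' : η t - A - (η t - B) = -(A - B) := by abel
  rw [e, e', norm_neg, ← hL] at key
  have ha2 := mul_le_mul_of_nonneg_left (pow_le_pow_left₀ (norm_nonneg _) ha 2) (sub_nonneg.2 h1)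
  have hb2 := mul_le_mul_of_nonneg_left (pow_le_pow_left₀ (norm_nonneg _) hb 2) h0
  have hq0 : 0 ≤ t * (1 - t) := mul_nonneg h0 (by linarith)
  have hq : t * (1 - t) ≤ 1 / 4 := by nlinarith [sq_nonneg (t - 1 / 2)]
  have hs := Real.sq_sqrt (show 0 ≤ 2 * ε + δ by linarith)
  have hx : 2 * ε + ε ^ 2 + 4 * δ * (1 + ε) ≤ 3 * ε + 8 * δ := by nlinarith
  have hx0 : 0 ≤ 3 * ε + 8 * δ := by linarith
  have hp : t * (1 - t) * (2 * ε + ε ^ 2 + 4 * δ * (1 + ε)) ≤ 1 / 4 * (3 * ε + 8 * δ) :=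
    (mul_le_mul_of_nonneg_left hx hq0).trans (mul_le_mul_of_nonneg_right hq hx0)
  have hfin : t * (1 - t) * (2 * ε + ε ^ 2 + 4 * δ * (1 + ε)) + δ ^ 2 ≤ 9 * (2 * ε + δ) := by
    nlinarith
  have hfinL := mul_le_mul_of_nonneg_right hfin (sq_nonneg L)
  refine (pow_le_pow_iff_left₀ (norm_nonneg _) (by positivity) two_ne_zero).1 ?_
  have hr : (3 * Real.sqrt (2 * ε + δ) * L) ^ 2 = 9 * (2 * ε + δ) * L ^ 2 := by
    rw [mul_pow, mul_pow, hs]; ring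
  rw [hr, key]
  refine le_trans ?_ hfinL
  linarith

/-- Two constant-speed curves of length at most `(1+ε)L` whose endpoints
are `δL`-close to `A` and `B` respectively are uniformly `6√(2ε+δ)L`-close. -/
theorem stmt_1
    (A B : EuclideanSpace ℝ (Fin 2)) (L ε δ : ℝ)
    (hL : L = ‖A - B‖) (hLpos : 0 < L)
    (hε0 : 0 ≤ ε) (hε1 : ε ≤ 1) (hδ0 : 0 ≤ δ) (hδ1 : δ ≤ 1)
    (η₁ η₂ : ℝ → EuclideanSpace ℝ (Fin 2)) (ℓ₁ ℓ₂ : ℝ)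
    (hℓ₁ : 0 ≤ ℓ₁) (hℓ₂ : 0 ≤ ℓ₂)
    (hspeed₁ : ∀ s t : ℝ, 0 ≤ s → s ≤ t → t ≤ 1 →
      eVariationOn η₁ (Set.Icc s t) = ENNReal.ofReal (ℓ₁ * (t - s)))
    (hspeed₂ : ∀ s t : ℝ, 0 ≤ s → s ≤ t → t ≤ 1 →
      eVariationOn η₂ (Set.Icc s t) = ENNReal.ofReal (ℓ₂ * (t - s)))
    (hlen₁ : ℓ₁ ≤ (1 + ε) * L) (hlen₂ : ℓ₂ ≤ (1 + ε) * L)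
    (hA₁ : ‖η₁ 0 - A‖ ≤ δ * L) (hB₁ : ‖η₁ 1 - B‖ ≤ δ * L)
    (hA₂ : ‖η₂ 0 - A‖ ≤ δ * L) (hB₂ : ‖η₂ 1 - B‖ ≤ δ * L) :
    ∀ t ∈ Set.Icc (0 : ℝ) 1,
      ‖η₁ t - η₂ t‖ ≤ 6 * Real.sqrt (2 * ε + δ) * L := by
  intro t ht
  have h1 := aux_curve A B L ε δ hL hLpos hε0 hε1 hδ0 hδ1 η₁ ℓ₁ hℓ₁ hspeed₁ hlen₁ hA₁ hB₁ t ht.1 ht.2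
  have h2 := aux_curve A B L ε δ hL hLpos hε0 hε1 hδ0 hδ1 η₂ ℓ₂ hℓ₂ hspeed₂ hlen₂ hA₂ hB₂ t ht.1 ht.2
  have h3 := norm_sub_le_norm_sub_add_norm_sub (η₁ t) ((1 - t) • A + t • B) (η₂ t)
  rw [norm_sub_rev ((1 - t) • A + t • B) (η₂ t)] at h3
  linarith
end

section
/- Let a < c < b be real numbers and let fₖ, f : (a,b) → ℝ² be such that fₖ(x) → f(x) for every x ∈ (a,b), the variation Var(f, (a,b)) is finite, Var(fₖ, (a,b)) → Var(f, (a,b)) as k → ∞, and f is continuous at c. Then Var(fₖ, (a,c)) → Var(f, (a,c)) and Var(fₖ, (c,b)) → Var(f, (c,b)) as k → ∞. -/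
open Set Filter MeasureTheory

theorem aux_min {u : ℕ → ENNReal} {A : ENNReal} (hu : ∀ x < A, ∀ᶠ k in atTop, x < u k) :
    Tendsto (fun k => min (u k) A) atTop (nhds A) := by
  rw [tendsto_order]
  refine ⟨fun x hx => ?_, fun x hx => ?_⟩
  · filter_upwards [hu x hx] with k hk
    exact lt_min hk hx
  · exact Eventually.of_forall fun k => (min_le_right _ _).trans_lt hx

theorem aux_lim {u v w : ℕ → ENNReal} {A B : ENNReal} (hB : B ≠ ⊤) (hA : A ≠ ⊤)
    (huv : ∀ k, u k + v k ≤ w k) (hw : Tendsto w atTop (nhds (A + B)))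
    (hu : ∀ x < A, ∀ᶠ k in atTop, x < u k) (hv : ∀ x < B, ∀ᶠ k in atTop, x < v k) :
    Tendsto u atTop (nhds A) := by
  have h1 := aux_min hu
  have h2 := ENNReal.Tendsto.sub hw (aux_min hv) (Or.inr hB)
  rw [ENNReal.add_sub_cancel_right hB] at h2
  refine tendsto_of_tendsto_of_tendsto_of_le_of_le h1 h2 (fun k => min_le_left _ _) fun k => ?_
  refine ENNReal.le_sub_of_add_le_right (ne_top_of_le_ne_top hB (min_le_right _ _)) ?_
  exact le_trans (by gcongr; exact min_le_left _ _) (huv k)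

/-- Strict BV convergence on `(a,b)` passes to the subintervals `(a,c)`
and `(c,b)` determined by a continuity point `c` of the limit. -/
theorem stmt_2 (a b c : ℝ) (hac : a < c) (hcb : c < b)
    (f : ℕ → ℝ → EuclideanSpace ℝ (Fin 2)) (g : ℝ → EuclideanSpace ℝ (Fin 2))
    (hpt : ∀ x ∈ Set.Ioo a b,
      Filter.Tendsto (fun k => f k x) Filter.atTop (nhds (g x)))
    (hfin : eVariationOn g (Set.Ioo a b) ≠ ⊤)
    (hvar : Filter.Tendsto (fun k => eVariationOn (f k) (Set.Ioo a b)) Filter.atTop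
      (nhds (eVariationOn g (Set.Ioo a b))))
    (hcont : ContinuousWithinAt g (Set.Ioo a b) c) :
    Filter.Tendsto (fun k => eVariationOn (f k) (Set.Ioo a c)) Filter.atTop
      (nhds (eVariationOn g (Set.Ioo a c))) ∧
    Filter.Tendsto (fun k => eVariationOn (f k) (Set.Ioo c b)) Filter.atTop
      (nhds (eVariationOn g (Set.Ioo c b))) := by
  have e1 : Ioo a b ∩ Iio c = Ioo a c := by
    ext x; simp only [mem_inter_iff, mem_Ioo, mem_Iio]; grind
  have e2 : Ioo a b ∩ Ioi c = Ioo c b := by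
    ext x; simp only [mem_inter_iff, mem_Ioo, mem_Ioi]; grind
  have s1 : Ioo a c ⊆ Ioo a b := Ioo_subset_Ioo_right hcb.le
  have s2 : Ioo c b ⊆ Ioo a b := Ioo_subset_Ioo_left hac.le
  have g1 : eVariationOn g (Ioo a b ∩ Iio c) = eVariationOn g (Ioo a b ∩ Iic c) := by
    apply eVariationOn.eVariationOn_inter_Iio_eq_inter_Iic_of_continuousWithinAt
    · rw [e1, nhdsWithin_Ioo_eq_nhdsLT hac]; infer_instance
    · exact hcont.mono inter_subset_left
  have g2 : eVariationOn g (Ioo a b ∩ Ioi c) = eVariationOn g (Ioo a b ∩ Ici c) := by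
    apply eVariationOn.eVariationOn_inter_Ioi_eq_inter_Ici_of_continuousWithinAt
    · rw [e2, nhdsWithin_Ioo_eq_nhdsGT hcb]; infer_instance
    · exact hcont.mono inter_subset_left
  have g3 : eVariationOn g (Ioo a b) = eVariationOn g (Ioo a c) + eVariationOn g (Ioo c b) := by
    rw [← e1, ← e2, g1, g2, ← eVariationOn.union g (s := Ioo a b ∩ Iic c)
      (t := Ioo a b ∩ Ici c) (x := c) ⟨⟨⟨hac, hcb⟩, self_mem_Iic⟩, fun x hx => hx.2⟩
      ⟨⟨⟨hac, hcb⟩, self_mem_Ici⟩, fun x hx => hx.2⟩, ← inter_union_distrib_left, Iic_union_Ici,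
      inter_univ]
  have hA := ne_top_of_le_ne_top hfin (eVariationOn.mono g s1)
  have hB := ne_top_of_le_ne_top hfin (eVariationOn.mono g s2)
  have huv : ∀ k, eVariationOn (f k) (Ioo a c) + eVariationOn (f k) (Ioo c b)
      ≤ eVariationOn (f k) (Ioo a b) := fun k =>
    (eVariationOn.add_le_union (f k) fun x hx y hy => (hx.2.trans hy.1).le).trans
      (eVariationOn.mono _ (union_subset s1 s2))
  have hu : ∀ x < eVariationOn g (Ioo a c), ∀ᶠ k in atTop, x < eVariationOn (f k) (Ioo a c) :=
    fun x hx => eVariationOn.lowerSemicontinuous_aux (fun y hy => hpt y (s1 hy)) hx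
  have hv : ∀ x < eVariationOn g (Ioo c b), ∀ᶠ k in atTop, x < eVariationOn (f k) (Ioo c b) :=
    fun x hx => eVariationOn.lowerSemicontinuous_aux (fun y hy => hpt y (s2 hy)) hx
  rw [g3] at hvar
  refine ⟨aux_lim hB hA huv hvar hu hv, aux_lim (w := fun k => eVariationOn (f k) (Ioo a b)) hA hB
    (fun k => ?_) ?_ hv hu⟩
  · rw [add_comm]; exact huv k
  · rw [add_comm]; exact hvar
end

section
/- Let K ∈ ℕ and let f : ℝ² → ℝ² be Lebesgue measurable such that for almost every x ∈ (−1,1) the vertical restriction t ↦ f(x,t) has bounded variation on (−1,1), and for almost every y ∈ (−1,1) the horizontal restriction t ↦ f(t,y) has bounded variation on (−1,1). Then for Lebesgue-almost every choice (with respect to 2K-dimensional Lebesgue measure) of points x₁, …, x_K ∈ (−1,1) and y₁, …, y_K ∈ (−1,1), it holds for all i, j ∈ {1, …, K} that the map t ↦ f(x_i,t) is continuous at y_j and the map t ↦ f(t,y_j) is continuous at x_i; equivalently, the restriction of f to the grid T = (⋃ⱼ {x_j} × [−1,1]) ∪ (⋃ₘ [−1,1] × {y_m}) is continuous at every cross (x_i,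 y_j). -/
open Set Filter MeasureTheory

lemma stmt_5_aux (g : ℝ × ℝ → EuclideanSpace ℝ (Fin 2)) (hg : Measurable g)
    (hBV : ∀ᵐ x ∂(volume.restrict (Set.Ioo (-1 : ℝ) 1)),
      eVariationOn (fun t => g (x, t)) (Set.Ioo (-1 : ℝ) 1) ≠ ⊤) :
    ∀ᵐ z ∂((volume : Measure ℝ).prod (volume : Measure ℝ)),
      z.1 ∈ Set.Ioo (-1 : ℝ) 1 → z.2 ∈ Set.Ioo (-1 : ℝ) 1 →
        ContinuousAt (fun t => g (z.1, t)) z.2 := by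
  have hBV' := (ae_restrict_iff' measurableSet_Ioo).1 hBV
  have hseqR : ∀ y : ℝ, Tendsto (fun n : ℕ => y + 1 / ((n : ℝ) + 1)) atTop (nhds y) := fun y => by
    simpa using (tendsto_const_nhds (x := y)).add
      (tendsto_one_div_add_atTop_nhds_zero_nat (𝕜 := ℝ))
  have hseqL : ∀ y : ℝ, Tendsto (fun n : ℕ => y - 1 / ((n : ℝ) + 1)) atTop (nhds y) := fun y => by
    simpa using (tendsto_const_nhds (x := y)).sub
      (tendsto_one_div_add_atTop_nhds_zero_nat (𝕜 := ℝ))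
  let R : Set (ℝ × ℝ) := {z | Tendsto
    (fun n : ℕ => dist (g (z.1, z.2 + 1 / ((n : ℝ) + 1))) (g z)) atTop (nhds 0)}
  let L : Set (ℝ × ℝ) := {z | Tendsto
    (fun n : ℕ => dist (g (z.1, z.2 - 1 / ((n : ℝ) + 1))) (g z)) atTop (nhds 0)}
  have hR : MeasurableSet R :=
    measurableSet_tendsto (nhds (0 : ℝ)) (fun n => (hg.comp (by fun_prop)).dist hg)
  have hL : MeasurableSet L :=
    measurableSet_tendsto (nhds (0 : ℝ)) (fun n => (hg.comp (by fun_prop)).dist hg)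
  let I : Set ℝ := Set.Ioo (-1 : ℝ) 1
  have hI : MeasurableSet (I ×ˢ I) := measurableSet_Ioo.prod measurableSet_Ioo
  have key : ∀ᵐ z ∂((volume : Measure ℝ).prod (volume : Measure ℝ)),
      z ∈ (I ×ˢ I)ᶜ ∪ (R ∩ L) := by
    rw [Measure.ae_prod_mem_iff_ae_ae_mem (hI.compl.union (hR.inter hL))]
    filter_upwards [hBV'] with x hx
    by_cases hxI : x ∈ I
    · have hb : BoundedVariationOn (fun t => g (x, t)) I := hx hxI
      filter_upwards [hb.locallyBoundedVariationOn.ae_differentiableWithinAt_of_mem] with y hy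
      by_cases hyI : y ∈ I
      · right
        have hc : ContinuousAt (fun t => g (x, t)) y :=
          (hy hyI).continuousWithinAt.continuousAt (isOpen_Ioo.mem_nhds hyI)
        exact ⟨tendsto_iff_dist_tendsto_zero.1 (hc.tendsto.comp (hseqR y)),
          tendsto_iff_dist_tendsto_zero.1 (hc.tendsto.comp (hseqL y))⟩
      · left; exact fun h => hyI h.2
    · exact Eventually.of_forall fun y => Or.inl fun h => hxI h.1
  have hBV2 : ∀ᵐ z ∂((volume : Measure ℝ).prod (volume : Measure ℝ)),
      z.1 ∈ I → eVariationOn (fun t => g (z.1, t)) I ≠ ⊤ :=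
    Measure.quasiMeasurePreserving_fst.ae hBV'
  filter_upwards [key, hBV2] with z hz hz2 h1 h2
  obtain ⟨x, y⟩ := z
  have hzz : (x, y) ∈ R ∩ L := hz.resolve_left fun h => h ⟨h1, h2⟩
  have hb : BoundedVariationOn (fun t => g (x, t)) I := hz2 h1
  have hIn : I ∈ nhds y := isOpen_Ioo.mem_nhds h2
  rw [continuousAt_iff_continuous_left'_right']
  constructor
  · obtain ⟨l, hl⟩ := hb.exists_tendsto_left y
    rw [nhdsWithin_inter_of_mem (mem_nhdsWithin_of_mem_nhds hIn)] at hl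
    have h3 : Tendsto (fun n : ℕ => y - 1 / ((n : ℝ) + 1)) atTop (nhdsWithin y (Iio y)) :=
      tendsto_nhdsWithin_iff.2 ⟨hseqL y, Eventually.of_forall fun n => by
        have : 0 < 1 / ((n : ℝ) + 1) := by positivity
        simp only [mem_Iio]; linarith⟩
    have h4 := tendsto_nhds_unique (hl.comp h3) (tendsto_iff_dist_tendsto_zero.2 hzz.2)
    subst h4
    exact hl
  · obtain ⟨l, hl⟩ := hb.exists_tendsto_right y
    rw [nhdsWithin_inter_of_mem (mem_nhdsWithin_of_mem_nhds hIn)] at hl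
    have h3 : Tendsto (fun n : ℕ => y + 1 / ((n : ℝ) + 1)) atTop (nhdsWithin y (Ioi y)) :=
      tendsto_nhdsWithin_iff.2 ⟨hseqR y, Eventually.of_forall fun n => by
        have : 0 < 1 / ((n : ℝ) + 1) := by positivity
        simp only [mem_Ioi]; linarith⟩
    have h4 := tendsto_nhds_unique (hl.comp h3) (tendsto_iff_dist_tendsto_zero.2 hzz.1)
    subst h4
    exact hl

/-- If `f` is measurable and BV on almost every vertical and horizontal
line of `(-1,1)²`, then for (2K-dimensional) Lebesgue-a.e. choice of coordinates
`x₁, …, x_K` and `y₁, …, y_K` in `(-1,1)`, the restriction of `f` to the grid determined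
by these coordinates is continuous at every cross `(x_i, y_j)`. -/
theorem stmt_5 (K : ℕ) (f : ℝ × ℝ → EuclideanSpace ℝ (Fin 2)) (hf : Measurable f)
    (hBVv : ∀ᵐ x ∂(volume.restrict (Set.Ioo (-1 : ℝ) 1)),
      eVariationOn (fun t => f (x, t)) (Set.Ioo (-1 : ℝ) 1) ≠ ⊤)
    (hBVh : ∀ᵐ y ∂(volume.restrict (Set.Ioo (-1 : ℝ) 1)),
      eVariationOn (fun t => f (t, y)) (Set.Ioo (-1 : ℝ) 1) ≠ ⊤) :
    ∀ᵐ p ∂(volume : Measure ((Fin K → ℝ) × (Fin K → ℝ))),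
      (∀ i, p.1 i ∈ Set.Ioo (-1 : ℝ) 1) → (∀ j, p.2 j ∈ Set.Ioo (-1 : ℝ) 1) →
        ∀ i j,
          ContinuousWithinAt (fun t => f (p.1 i, t)) (Set.Icc (-1 : ℝ) 1) (p.2 j) ∧
          ContinuousWithinAt (fun t => f (t, p.2 j)) (Set.Icc (-1 : ℝ) 1) (p.1 i) := by
  have H1 := stmt_5_aux f hf hBVv
  have H2 := stmt_5_aux (fun z => f z.swap) (hf.comp measurable_swap) hBVh
  have H : ∀ i j, ∀ᵐ p ∂(volume : Measure ((Fin K → ℝ) × (Fin K → ℝ))),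
      p.1 i ∈ Set.Ioo (-1 : ℝ) 1 → p.2 j ∈ Set.Ioo (-1 : ℝ) 1 →
        ContinuousAt (fun t => f (p.1 i, t)) (p.2 j) ∧
        ContinuousAt (fun t => f (t, p.2 j)) (p.1 i) := by
    intro i j
    have q1 : Measure.QuasiMeasurePreserving
        (fun p : (Fin K → ℝ) × (Fin K → ℝ) => (p.1 i, p.2 j))
        ((volume : Measure (Fin K → ℝ)).prod (volume : Measure (Fin K → ℝ)))
        ((volume : Measure ℝ).prod (volume : Measure ℝ)) := by
      have e1 := Measure.quasiMeasurePreserving_eval (fun _ : Fin K => (volume : Measure ℝ)) i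
      have e2 := Measure.quasiMeasurePreserving_eval (fun _ : Fin K => (volume : Measure ℝ)) j
      refine ⟨by fun_prop, ?_⟩
      have e3 := e1.absolutelyContinuous.prod e2.absolutelyContinuous
      rw [Measure.map_prod_map _ _ e1.measurable e2.measurable] at e3
      exact e3
    have q2 := (Measure.measurePreserving_swap (μ := (volume : Measure ℝ))
      (ν := (volume : Measure ℝ))).quasiMeasurePreserving.comp q1
    filter_upwards [q1.ae H1, q2.ae H2] with p h1 h2 hi hj
    exact ⟨h1 hi hj, h2 hj hi⟩
  have H' := ae_all_iff.2 fun i => ae_all_iff.2 (H i)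
  filter_upwards [H'] with p hp hi hj i j
  exact ⟨(hp i j (hi i) (hj j)).1.continuousWithinAt, (hp i j (hi i) (hj j)).2.continuousWithinAt⟩
end

section
/- Let g : [−1,1] → ℝ² have finite variation V := Var(g, [−1,1]) < ∞, and define l : [−1,1] → ℝ by l(y) = (y + 1 + Var(g, [−1,y))) / (2 + V). Then: (i) l is strictly increasing and takes values in [0,1]; and (ii) there exists a map φ : [0,1] → ℝ² that is Lipschitz with constant 2 + V and satisfies φ(l(y)) = g(y) for every point y ∈ [−1,1] at which g is continuous (as a function on [−1,1]). -/
open Set Filter MeasureTheory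

lemma aux_interp {E : Type*} [NormedAddCommGroup E] [NormedSpace ℝ E] {T : Set ℝ} (hT : IsClosed T)
    {m M : ℝ} (hm : m ∈ T) (hM : M ∈ T) {F : ℝ → E} {K : NNReal} (hF : LipschitzOnWith K F T) :
    ∃ φ : ℝ → E, LipschitzOnWith K φ (Set.Icc m M) ∧ ∀ x ∈ T, φ x = F x := by
  let a : ℝ → ℝ := fun x => sSup (T ∩ Set.Iic x)
  let b : ℝ → ℝ := fun x => sInf (T ∩ Set.Ici x)
  have hbdA : ∀ x, BddAbove (T ∩ Set.Iic x) := fun x => ⟨x, fun y hy => hy.2⟩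
  have hbdB : ∀ x, BddBelow (T ∩ Set.Ici x) := fun x => ⟨x, fun y hy => hy.2⟩
  have ha : ∀ x, m ≤ x → a x ∈ T ∩ Set.Iic x := fun x hx =>
    (hT.inter isClosed_Iic).csSup_mem ⟨m, hm, hx⟩ (hbdA x)
  have hb : ∀ x, x ≤ M → b x ∈ T ∩ Set.Ici x := fun x hx =>
    (hT.inter isClosed_Ici).csInf_mem ⟨M, hM, hx⟩ (hbdB x)
  have ha' : ∀ x t, t ∈ T → t ≤ x → t ≤ a x := fun x t ht htx => le_csSup (hbdA x) ⟨ht, htx⟩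
  have hb' : ∀ x t, t ∈ T → x ≤ t → b x ≤ t := fun x t ht htx => csInf_le (hbdB x) ⟨ht, htx⟩
  let φ : ℝ → E := fun x => AffineMap.lineMap (F (a x)) (F (b x)) ((x - a x) / (b x - a x))
  have hFd : ∀ s ∈ T, ∀ t ∈ T, s ≤ t → dist (F s) (F t) ≤ K * (t - s) := by
    intro s hs t ht hst
    have := hF.dist_le_mul s hs t ht
    rwa [dist_comm s t, Real.dist_eq, abs_of_nonneg (by linarith)] at this
  -- key segment bound
  have key : ∀ s ∈ T, ∀ t ∈ T, s ≤ t → ∀ x y, s ≤ x → x ≤ y → y ≤ t →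
      dist (AffineMap.lineMap (F s) (F t) ((x - s) / (t - s)) : E)
        (AffineMap.lineMap (F s) (F t) ((y - s) / (t - s))) ≤ K * (y - x) := by
    intro s hs t ht hst x y hsx hxy hyt
    rcases hst.eq_or_lt with h | h
    · subst h
      have : x = s := by linarith
      have : y = s := by linarith
      subst x; subst y; simp
    · rw [dist_lineMap_lineMap, dist_comm, Real.dist_eq]
      have h1 : (y - s) / (t - s) - (x - s) / (t - s) = (y - x) / (t - s) := by ring
      have h0 : 0 < t - s := by linarith
      rw [h1, abs_of_nonneg (div_nonneg (by linarith) h0.le)]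
      calc (y - x) / (t - s) * dist (F s) (F t) ≤ (y - x) / (t - s) * (K * (t - s)) :=
            mul_le_mul_of_nonneg_left (hFd s hs t ht hst) (div_nonneg (by linarith) h0.le)
        _ = K * (y - x) := by field_simp
  have end0 : ∀ s t : ℝ, (AffineMap.lineMap (F s) (F t) ((s - s) / (t - s)) : E) = F s := by
    intro s t; simp
  have end1 : ∀ s t : ℝ, (AffineMap.lineMap (F s) (F t) ((t - s) / (t - s)) : E) = F t := by
    intro s t
    by_cases h : t - s = 0
    · have : t = s := by linarith
      subst this; simp
    · rw [div_self h]; simp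
  refine ⟨φ, ?_, ?_⟩
  · have main : ∀ x ∈ Set.Icc m M, ∀ y ∈ Set.Icc m M, x ≤ y → dist (φ x) (φ y) ≤ K * (y - x) := by
      intro x hx y hy hxy
      obtain ⟨ax, ax'⟩ := ha x hx.1
      obtain ⟨ay, ay'⟩ := ha y hy.1
      obtain ⟨bx, bx'⟩ := hb x hx.2
      obtain ⟨by1, by'⟩ := hb y hy.2
      simp only [Set.mem_Iic, Set.mem_Ici] at ax' ay' bx' by'
      by_cases h : ∃ t ∈ T, x ≤ t ∧ t ≤ y
      · obtain ⟨t, ht, hxt, hty⟩ := h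
        have h1 := ha' y t ht hty
        have h2 := hb' x t ht hxt
        have k1 := key (a x) ax (b x) bx (ax'.trans bx') x (b x) ax' bx' le_rfl
        have k2 := key (a y) ay (b y) by1 (ay'.trans by') (a y) y le_rfl ay' by'
        rw [end1] at k1
        rw [end0] at k2
        have k3 := hFd _ bx _ ay (h2.trans h1)
        have := dist_triangle4 (φ x) (F (b x)) (F (a y)) (φ y)
        have k1' : dist (φ x) (F (b x)) ≤ K * (b x - x) := k1
        have k2' : dist (F (a y)) (φ y) ≤ K * (y - a y) := k2
        nlinarith
      · push Not at h
        have e1 : a y = a x := by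
          apply le_antisymm
          · apply ha' x _ ay
            by_contra hc
            exact absurd (h _ ay (not_le.1 hc).le) (by linarith)
          · exact ha' y _ ax (ax'.trans hxy)
        have e2 : b x = b y := by
          apply le_antisymm
          · exact hb' x _ by1 (hxy.trans by')
          · exact hb' y _ bx (h _ bx bx').le
        have := key (a x) ax (b x) bx (ax'.trans bx') x y ax' hxy (e2 ▸ by')
        simp only [φ, e1, ← e2]
        exact this
    refine LipschitzOnWith.of_dist_le_mul fun x hx y hy => ?_
    rcases le_total x y with h | h
    · rw [dist_comm x y, Real.dist_eq, abs_of_nonneg (by linarith)]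
      exact main x hx y hy h
    · rw [dist_comm, Real.dist_eq, abs_of_nonneg (by linarith)]
      exact main y hy x hx h
  · intro x hx
    have e1 : a x = x := le_antisymm (csSup_le ⟨x, hx, Set.self_mem_Iic⟩ fun y hy => hy.2) (ha' x x hx le_rfl)
    simp only [φ, e1]
    simp

lemma aux_extend {S : Set ℝ} (hS : S ⊆ Set.Icc 0 1) {f : ℝ → EuclideanSpace ℝ (Fin 2)} {K : NNReal}
    (hf : LipschitzOnWith K f S) :
    ∃ φ : ℝ → EuclideanSpace ℝ (Fin 2), LipschitzOnWith K φ (Set.Icc 0 1) ∧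
      ∀ x ∈ S, φ x = f x := by
  rcases S.eq_empty_or_nonempty with rfl | hne
  · exact ⟨fun _ => 0, (LipschitzWith.const' 0).lipschitzOnWith, by simp⟩
  obtain ⟨h, hh, hfh⟩ := hf.extend_finite_dimension
  have hhS : LipschitzOnWith K h S := by
    intro x hx y hy
    rw [← hfh hx, ← hfh hy]
    exact hf hx hy
  have hhT := LipschitzOnWith.closure hh.continuous.continuousOn hhS
  have hTs : closure S ⊆ Set.Icc 0 1 := closure_minimal hS isClosed_Icc
  have hc : IsCompact (closure S) := isCompact_Icc.of_isClosed_subset isClosed_closure hTs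
  obtain ⟨m, hm⟩ := hc.exists_isLeast hne.closure
  obtain ⟨M, hM⟩ := hc.exists_isGreatest hne.closure
  obtain ⟨ψ, hψ, hψe⟩ := aux_interp isClosed_closure hm.1 hM.1 hhT
  have hmM : m ≤ M := hm.2 hM.1
  refine ⟨fun x => ψ (Set.projIcc m M hmM x), ?_, ?_⟩
  · have hp : LipschitzWith 1 (Set.projIcc m M hmM) := LipschitzWith.projIcc hmM
    intro x hx y hy
    refine (hψ (Set.projIcc m M hmM x).2 (Set.projIcc m M hmM y).2).trans ?_
    gcongr
    have := hp x y
    rw [ENNReal.coe_one, one_mul] at this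
    exact this
  · intro x hx
    have hxT := subset_closure hx
    have : x ∈ Set.Icc m M := ⟨hm.2 hxT, hM.2 hxT⟩
    simp only [Set.projIcc_of_mem hmM this]
    rw [hψe x hxT, hfh hx]

lemma aux_cont {g : ℝ → EuclideanSpace ℝ (Fin 2)} {y : ℝ} (hy : y ∈ Set.Icc (-1 : ℝ) 1)
    (hg : ContinuousWithinAt g (Set.Icc (-1 : ℝ) 1) y) :
    eVariationOn g (Set.Ico (-1) y) = eVariationOn g (Set.Icc (-1) y) := by
  rcases hy.1.eq_or_lt with h | h
  · subst h
    simp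
  · apply eVariationOn.eVariationOn_Ico_eq_Icc_of_continuousWithinAt
    apply hg.mono_of_mem_nhdsWithin
    exact Filter.mem_of_superset (Icc_mem_nhdsLE h) (Set.Icc_subset_Icc_right hy.2)

/-- Construction of the geometrical representative of a one-dimensional
BV map `g : [-1,1] → ℝ²`: the normalized arclength function
`l(y) = (y + 1 + Var(g,[-1,y))) / (2 + V)` is strictly increasing with values in `[0,1]`,
and there is a `(2+V)`-Lipschitz map `φ : [0,1] → ℝ²` with `φ(l y) = g y` at every
continuity point `y` of `g`. -/
theorem stmt_9 (g : ℝ → EuclideanSpace ℝ (Fin 2))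
    (hfin : eVariationOn g (Set.Icc (-1 : ℝ) 1) ≠ ⊤) :
    let V : ℝ := (eVariationOn g (Set.Icc (-1 : ℝ) 1)).toReal
    let l : ℝ → ℝ :=
      fun y => (y + 1 + (eVariationOn g (Set.Ico (-1 : ℝ) y)).toReal) / (2 + V)
    StrictMonoOn l (Set.Icc (-1 : ℝ) 1) ∧
    (∀ y ∈ Set.Icc (-1 : ℝ) 1, l y ∈ Set.Icc (0 : ℝ) 1) ∧
    ∃ φ : ℝ → EuclideanSpace ℝ (Fin 2),
      LipschitzOnWith (Real.toNNReal (2 + V)) φ (Set.Icc (0 : ℝ) 1) ∧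
      ∀ y ∈ Set.Icc (-1 : ℝ) 1,
        ContinuousWithinAt g (Set.Icc (-1 : ℝ) 1) y → φ (l y) = g y := by
  intro V l
  have hV : 0 ≤ V := ENNReal.toReal_nonneg
  have hV2 : 0 < 2 + V := by linarith
  have hfy : ∀ y ∈ Set.Icc (-1 : ℝ) 1, Set.Ico (-1 : ℝ) y ⊆ Set.Icc (-1) 1 :=
    fun y hy z hz => ⟨hz.1, hz.2.le.trans hy.2⟩
  have hne : ∀ s ⊆ Set.Icc (-1 : ℝ) 1, eVariationOn g s ≠ ⊤ := fun s hs =>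
    ne_top_of_le_ne_top hfin (eVariationOn.mono g hs)
  have hmono : StrictMonoOn l (Set.Icc (-1 : ℝ) 1) := by
    intro x hx y hy hxy
    have : (eVariationOn g (Set.Ico (-1 : ℝ) x)).toReal ≤
        (eVariationOn g (Set.Ico (-1 : ℝ) y)).toReal :=
      ENNReal.toReal_mono (hne _ (hfy y hy))
        (eVariationOn.mono g (Set.Ico_subset_Ico_right hxy.le))
    exact div_lt_div_of_pos_right (by linarith) hV2
  have hmem : ∀ y ∈ Set.Icc (-1 : ℝ) 1, l y ∈ Set.Icc (0 : ℝ) 1 := by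
    intro y hy
    have h1 : (eVariationOn g (Set.Ico (-1 : ℝ) y)).toReal ≤ V :=
      ENNReal.toReal_mono hfin (eVariationOn.mono g (hfy y hy))
    have h0 : 0 ≤ (eVariationOn g (Set.Ico (-1 : ℝ) y)).toReal := ENNReal.toReal_nonneg
    have h2 := hy.1
    have h3 := hy.2
    exact ⟨div_nonneg (by linarith) hV2.le, (div_le_one hV2).2 (by linarith)⟩
  refine ⟨hmono, hmem, ?_⟩
  let C : Set ℝ := {y | y ∈ Set.Icc (-1 : ℝ) 1 ∧ ContinuousWithinAt g (Set.Icc (-1 : ℝ) 1) y}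
  have hCi : Set.InjOn l C := hmono.injOn.mono fun y hy => hy.1
  have hinv : ∀ y ∈ C, Function.invFunOn l C (l y) = y := fun y hy =>
    hCi.leftInvOn_invFunOn hy
  have main : ∀ x ∈ C, ∀ y ∈ C, x ≤ y → dist (g x) (g y) ≤ (2 + V) * (l y - l x) := by
    intro x hx y hy hxy
    have e : (2 + V) * (l y - l x) = (y - x) + ((eVariationOn g (Set.Ico (-1 : ℝ) y)).toReal -
        (eVariationOn g (Set.Ico (-1 : ℝ) x)).toReal) := by
      simp only [l]
      field_simp
      ring
    rw [e, aux_cont hx.1 hx.2, aux_cont hy.1 hy.2]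
    have hadd := eVariationOn.Icc_add_Icc g (s := Set.univ) hx.1.1 hxy (Set.mem_univ x)
    simp only [Set.univ_inter] at hadd
    have f1 := hne (Set.Icc (-1) x) (Set.Icc_subset_Icc_right hx.1.2)
    have f2 := hne (Set.Icc x y) (Set.Icc_subset_Icc hx.1.1 hy.1.2)
    rw [← hadd, ENNReal.toReal_add f1 f2]
    have := BoundedVariationOn.dist_le (f := g) f2 (Set.left_mem_Icc.2 hxy) (Set.right_mem_Icc.2 hxy)
    linarith
  have hL : LipschitzOnWith (Real.toNNReal (2 + V)) (fun t => g (Function.invFunOn l C t))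
      (l '' C) := by
    refine LipschitzOnWith.of_dist_le_mul ?_
    rintro _ ⟨x, hx, rfl⟩ _ ⟨y, hy, rfl⟩
    simp only [hinv x hx, hinv y hy]
    rw [Real.coe_toNNReal _ hV2.le]
    rcases le_total x y with h | h
    · have := hmono.monotoneOn hx.1 hy.1 h
      rw [dist_comm (l x), Real.dist_eq, abs_of_nonneg (by linarith)]
      exact main x hx y hy h
    · have := hmono.monotoneOn hy.1 hx.1 h
      rw [dist_comm (g x), Real.dist_eq, abs_of_nonneg (by linarith)]
      exact main y hy x hx h
  obtain ⟨φ, hφ, hφe⟩ := aux_extend (by rintro _ ⟨x, hx, rfl⟩; exact hmem x hx.1) hL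
  refine ⟨φ, hφ, fun y hy hc => ?_⟩
  rw [hφe _ ⟨y, ⟨hy, hc⟩, rfl⟩, hinv y ⟨hy, hc⟩]
end
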